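/- arXiv:1310.6146 — 2 statements merged into one kernel-verified Lean document; each statement's English description precedes it below -/
import Mathlib

section
/- First-derivative bound for the SRK stage values: Suppose b^0=a, b^1,…,b^m:ℝ^d→ℝ^d are continuously differentiable with ‖b^k(x)‖ ≤ C_1(1+‖x‖) and all first-order partial derivatives of all b^k bounded in absolute value by L. Let C_2 ≥ 1 bound the operator norms of all coefficient matrices B^{(ι)(k,ν),(r,μ)} and A^{(k,ν),(0,0)} as in the stage-value bound. Then there exist constants c>0 and C>0, depending only on d, m, s, |M|, C_1, C_2 and L, with the following property: if θ↦(H_i^{(k,ν)}(θ)) is a continuously differentiable family solving the stage equations identically for θ in a neighbourhood of a point θ* with max_{ι∈M̄}|θ*_ι| ≤ c and starting value Y_n, then max over components J and all (k,ν) of | Σ_{ν_1∈M̄} ∂H^{(k,ν),J}/∂θ_{ν_1}(θ*) | ≤ C(1+‖Y_n‖). -/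
open scoped BigOperators
open Finset MeasureTheory ProbabilityTheory

noncomputable section

namespace SRKPaper

/-- `ℝ^d` with the Euclidean norm. -/
abbrev Evec (d : ℕ) : Type := EuclideanSpace ℝ (Fin d)

/-- The index pairs `(k,ν)` of the SRK method: `det` is `(0,0)`,
`sto k ν` is `(k,ν)` with `k ∈ {1,…,m}`, `ν ∈ M`. -/
inductive SIdx (m : ℕ) (M : Type) : Type where
  | det : SIdx m M
  | sto : Fin m → M → SIdx m M

/-- `M̄ = M ∪ {0}`, with `none` playing the role of the index `0`. -/
abbrev Mbar (M : Type) : Type := Option M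

/-- The real coefficients of an autonomous `s`-stage stochastic Runge–Kutta method. -/
structure SRK (m s : ℕ) (M : Type) : Type where
  α : Fin s → ℝ
  γc : M → SIdx m M → Fin s → ℝ
  A : SIdx m M → Fin s → Fin s → ℝ
  B : M → SIdx m M → Fin m → M → Fin s → Fin s → ℝ

variable {d m s : ℕ} {M : Type}

section SRKdefs
variable [Fintype M]

/-- θ-dependent weights `z^{(k,ν)}`. -/
def SRK.z (c : SRK m s M) (θ : Mbar M → ℝ) : SIdx m M → Fin s → ℝ
  | .det => fun i => c.α i * θ none
  | .sto k ν => fun i => ∑ ι : M, c.γc ι (.sto k ν) i * θ (some ι)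

/-- θ-dependent stage coefficients `Z^{(k,ν),(r,μ)}`; the first index is the
father pair `p = (k,ν)`, the second the son pair. -/
def SRK.Z (c : SRK m s M) (θ : Mbar M → ℝ) (p : SIdx m M) : SIdx m M → Fin s → Fin s → ℝ
  | .det => fun i j => c.A p i j * θ none
  | .sto r μ => fun i j => ∑ ι : M, c.B ι p r μ i j * θ (some ι)

/-- The stage equations of the autonomous SRK method with starting value `y0`. -/
def StageEq (c : SRK m s M) (a : Evec d → Evec d) (b : Fin m → Evec d → Evec d)
    (y0 : Evec d) (θ : Mbar M → ℝ) (H : SIdx m M → Fin s → Evec d) : Prop :=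
  ∀ (p : SIdx m M) (i : Fin s),
    H p i = y0 + (∑ j, c.Z θ p .det i j • a (H .det j))
      + ∑ j, ∑ r, ∑ μ, c.Z θ p (.sto r μ) i j • b r (H (.sto r μ) j)

/-- The one-step value `Y(t)` of the SRK method. -/
def oneStep (c : SRK m s M) (a : Evec d → Evec d) (b : Fin m → Evec d → Evec d)
    (y0 : Evec d) (θ : Mbar M → ℝ) (H : SIdx m M → Fin s → Evec d) : Evec d :=
  y0 + (∑ i, c.z θ .det i • a (H .det i))
    + ∑ i, ∑ k, ∑ ν, c.z θ (.sto k ν) i • b k (H (.sto k ν) i)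

end SRKdefs

/-- A monotonically labelled S-tree with `l+1` nodes: node `0` is the root, the
nonroot nodes are labelled `1,…,l` and are represented by `Fin l` (node `i : Fin l`
has true label `i+1`).  `father i` is the father of node `i+1` (a node label in
`Fin (l+1)`), and `color i` is the colour of node `i+1`: `none` is a deterministic
node `τ`, `some j` a stochastic node `σ_j` with (concrete) variable index `j`. -/
structure STree (l m : ℕ) : Type where
  father : Fin l → Fin (l + 1)
  color : Fin l → Option (Fin m)
  mono : ∀ i : Fin l, (father i).val ≤ i.val

def STree.equivSubtype (l m : ℕ) :
    STree l m ≃ {p : (Fin l → Fin (l+1)) × (Fin l → Option (Fin m)) //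
      ∀ i : Fin l, (p.1 i).val ≤ i.val} where
  toFun t := ⟨(t.father, t.color), t.mono⟩
  invFun p := ⟨p.1.1, p.1.2, p.2⟩
  left_inv t := rfl
  right_inv p := rfl

instance (l m : ℕ) : Fintype (STree l m) := Fintype.ofEquiv _ (STree.equivSubtype l m).symm

/-- The set of sons of the node with label `v`. -/
def STree.child {l m : ℕ} (t : STree l m) (v : Fin (l+1)) : Finset (Fin l) :=
  Finset.univ.filter fun i => t.father i = v

/-- interpretation of a colour by the corresponding coefficient function (`b^0 = a`). -/
def nodeFun (a : Evec d → Evec d) (b : Fin m → Evec d → Evec d) :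
    Option (Fin m) → Evec d → Evec d
  | none => a
  | some j => b j

/-- The elementary differential attached to the subtree rooted at the nonroot node `i`
(fuel-based recursion; the fuel `l` always suffices). -/
def elemFAux (a : Evec d → Evec d) (b : Fin m → Evec d → Evec d) {l : ℕ} (t : STree l m) :
    ℕ → Fin l → Evec d → Evec d
  | 0, _, _ => 0
  | fuel + 1, i, x =>
      iteratedFDeriv ℝ (t.child i.succ).card (nodeFun a b (t.color i)) x
        fun p => elemFAux a b t fuel ((t.child i.succ).orderIsoOfFin rfl p).1 x

def elemF (a : Evec d → Evec d) (b : Fin m → Evec d → Evec d) {l : ℕ} (t : STree l m)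
    (i : Fin l) : Evec d → Evec d := elemFAux a b t l i

/-- The elementary differential `F(t)(x)` of a tree whose root has colour `γ`
(representing the functional `f`). -/
def elemFRoot (f : Evec d → ℝ) (a : Evec d → Evec d) (b : Fin m → Evec d → Evec d)
    {l : ℕ} (t : STree l m) (x : Evec d) : ℝ :=
  iteratedFDeriv ℝ (t.child 0).card f x
    fun p => elemF a b t ((t.child 0).orderIsoOfFin rfl p).1 x

/-- The elementary differential `F(t)(x)` of a tree whose root has colour `rc`
(`none = τ`, `some j = σ_j`). -/
def elemFRootV (a : Evec d → Evec d) (b : Fin m → Evec d → Evec d) (rc : Option (Fin m))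
    {l : ℕ} (t : STree l m) (x : Evec d) : Evec d :=
  iteratedFDeriv ℝ (t.child 0).card (nodeFun a b rc) x
    fun p => elemF a b t ((t.child 0).orderIsoOfFin rfl p).1 x

/-- number of nodes of the subtree rooted at the nonroot node `i` (fuel-based). -/
def sizeAux {l m : ℕ} (t : STree l m) : ℕ → Fin l → ℕ
  | 0, _ => 0
  | fuel + 1, i => 1 + ∑ c ∈ t.child i.succ, sizeAux t fuel c

def STree.size {l m : ℕ} (t : STree l m) (i : Fin l) : ℕ := sizeAux t l i

/-- density of the subtree rooted at the nonroot node `i`. -/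
def densAux {l m : ℕ} (t : STree l m) : ℕ → Fin l → ℕ
  | 0, _ => 1
  | fuel + 1, i => t.size i * ∏ c ∈ t.child i.succ, densAux t fuel c

def STree.densNode {l m : ℕ} (t : STree l m) (i : Fin l) : ℕ := densAux t l i

/-- density `γ(t)` of a tree whose root has colour `γ`. -/
def STree.densDelta {l m : ℕ} (t : STree l m) : ℕ := ∏ c ∈ t.child 0, t.densNode c

/-- density `γ(t)` of a tree (with `l+1` nodes) whose root has colour `τ` or `σ_j`. -/
def STree.densR {l m : ℕ} (t : STree l m) : ℕ := (l+1) * ∏ c ∈ t.child 0, t.densNode c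

/-- number `s(t)` of stochastic nonroot nodes. -/
def STree.scount {l m : ℕ} (t : STree l m) : ℕ :=
  (Finset.univ.filter fun i : Fin l => (t.color i).isSome = true).card

/-- number `d(t)` of deterministic nonroot nodes. -/
def STree.dcount {l m : ℕ} (t : STree l m) : ℕ :=
  (Finset.univ.filter fun i : Fin l => t.color i = none).card

section PhiDefs
variable [Fintype M]

/-- The vector `Ψ^{(p)}` of the subtree rooted at the nonroot node `i`, where `p` is
the index pair of the father of `i` (fuel-based recursion). -/
def PsiAux (c : SRK m s M) (θ : Mbar M → ℝ) {l : ℕ} (t : STree l m) :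
    ℕ → Fin l → SIdx m M → Fin s → ℝ
  | 0, _, _, _ => 1
  | fuel + 1, i, p, q =>
    match t.color i with
    | none => ∑ j, c.Z θ p .det q j * ∏ cc ∈ t.child i.succ, PsiAux c θ t fuel cc .det j
    | some jj => ∑ μ : M, ∑ j, c.Z θ p (.sto jj μ) q j *
        ∏ cc ∈ t.child i.succ, PsiAux c θ t fuel cc (.sto jj μ) j

def PsiN (c : SRK m s M) (θ : Mbar M → ℝ) {l : ℕ} (t : STree l m)
    (i : Fin l) (p : SIdx m M) (q : Fin s) : ℝ := PsiAux c θ t l i p q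

/-- the elementary-weight factor contributed by the subtree rooted at a son of the root. -/
def phiFactor (c : SRK m s M) (θ : Mbar M → ℝ) {l : ℕ} (t : STree l m) (i : Fin l) : ℝ :=
  match t.color i with
  | none => ∑ j, c.z θ .det j * ∏ cc ∈ t.child i.succ, PsiN c θ t cc .det j
  | some jj => ∑ μ : M, ∑ j, c.z θ (.sto jj μ) j *
      ∏ cc ∈ t.child i.succ, PsiN c θ t cc (.sto jj μ) j

/-- The elementary weight `Φ_S(t)` of a `γ`-rooted tree. -/
def PhiS (c : SRK m s M) (θ : Mbar M → ℝ) {l : ℕ} (t : STree l m) : ℝ :=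
  ∏ i ∈ t.child 0, phiFactor c θ t i

/-- `∑_{i₁} Z^{(k,ν)}_{i,i₁} Φ_{i₁}(t)` for a tree with root colour `rc`, the sum over
the pair `(j_r,ν_r)` of the root being shared between the `Z`-factor and `Φ`. -/
def ZPhi (c : SRK m s M) (θ : Mbar M → ℝ) (p : SIdx m M) (i : Fin s)
    (rc : Option (Fin m)) {l : ℕ} (t : STree l m) : ℝ :=
  match rc with
  | none => ∑ i1, c.Z θ p .det i i1 * ∏ cc ∈ t.child 0, PsiN c θ t cc .det i1
  | some jr => ∑ ν : M, ∑ i1, c.Z θ p (.sto jr ν) i i1 *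
      ∏ cc ∈ t.child 0, PsiN c θ t cc (.sto jr ν) i1

/-- `∑_{i₁} z_{i₁} Φ_{i₁}(t)` for a tree with root colour `rc`. -/
def zPhi (c : SRK m s M) (θ : Mbar M → ℝ)
    (rc : Option (Fin m)) {l : ℕ} (t : STree l m) : ℝ :=
  match rc with
  | none => ∑ i1, c.z θ .det i1 * ∏ cc ∈ t.child 0, PsiN c θ t cc .det i1
  | some jr => ∑ ν : M, ∑ i1, c.z θ (.sto jr ν) i1 *
      ∏ cc ∈ t.child 0, PsiN c θ t cc (.sto jr ν) i1

end PhiDefs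

/-- `D^q` with increments `Δ` applied to `g` at the point `θ0`:
`∑_{ν₁,…,ν_q ∈ M̄} Δθ_{ν₁}⋯Δθ_{ν_q} ∂^q g/(∂θ_{ν₁}⋯∂θ_{ν_q})(θ0)`. -/
def Dq {ι : Type} [Fintype ι] [DecidableEq ι] {F : Type}
    [NormedAddCommGroup F] [NormedSpace ℝ F]
    (q : ℕ) (Δ : ι → ℝ) (g : (ι → ℝ) → F) (θ0 : ι → ℝ) : F :=
  ∑ νs : Fin q → ι, (∏ r, Δ (νs r)) •
    iteratedFDeriv ℝ q g θ0 fun r => Pi.single (νs r) 1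

/-- `∑_{ν₁,…,ν_q ∈ M̄} ∂^q g/(∂θ_{ν₁}⋯∂θ_{ν_q})(θ0)`. -/
def DerSum {ι : Type} [Fintype ι] [DecidableEq ι] {F : Type}
    [NormedAddCommGroup F] [NormedSpace ℝ F]
    (q : ℕ) (g : (ι → ℝ) → F) (θ0 : ι → ℝ) : F :=
  ∑ νs : Fin q → ι, iteratedFDeriv ℝ q g θ0 fun r => Pi.single (νs r) 1

/-- the space `C_P^l`: `l` times continuously differentiable with all derivatives up
to order `l` of polynomial growth. -/
def IsCP {d : ℕ} {F : Type} [NormedAddCommGroup F] [NormedSpace ℝ F]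
    (l : ℕ) (g : Evec d → F) : Prop :=
  ContDiff ℝ l g ∧ ∀ i : ℕ, i ≤ l → ∃ K > (0:ℝ), ∃ r : ℕ,
    ∀ x, ‖iteratedFDeriv ℝ i g x‖ ≤ K * (1 + ‖x‖ ^ (2*r))

/-- A labelled tree is special if no node except possibly the root has more than one son. -/
def IsSpecial {q : ℕ} (t : STree q 0) : Prop :=
  ∀ i : Fin q, (t.child i.succ).card ≤ 1

instance {q : ℕ} : DecidablePred (IsSpecial (q := q)) := fun t => by
  unfold IsSpecial; infer_instance

end SRKPaper

namespace SRKPaper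

instance {m : ℕ} {M : Type} [Finite M] : Finite (SIdx m M) :=
  Finite.of_injective
    (fun p : SIdx m M => (match p with
      | .det => none
      | .sto r μ => some (r, μ) : Option (Fin m × M)))
    (by rintro (_ | _) (_ | _) h <;> simp_all)

/-- A finite family of reals that satisfies a contraction estimate is bounded. -/
lemma le_two_mul_of_contraction {ι : Type*} [Finite ι] {f : ι → ℝ} {A : ℝ}
    (h : ∀ X, (∀ i, f i ≤ X) → ∀ i, f i ≤ A + X / 2) (i : ι) : f i ≤ 2 * A := by
  have : Nonempty ι := ⟨i⟩
  obtain ⟨i₀, hi₀⟩ := Finite.exists_max f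
  have := h (f i₀) hi₀ i₀
  linarith [hi₀ i]

lemma fderiv_coord_apply {E : Type*} [NormedAddCommGroup E] [NormedSpace ℝ E] {d : ℕ}
    {f : E → Evec d} {x : E} (hf : DifferentiableAt ℝ f x) (J : Fin d) (w : E) :
    fderiv ℝ (fun y => f y J) x w = (fderiv ℝ f x w) J := by
  have h : HasFDerivAt (fun y => f y J)
      ((EuclideanSpace.proj J : Evec d →L[ℝ] ℝ).comp (fderiv ℝ f x)) x :=
    (EuclideanSpace.proj J : Evec d →L[ℝ] ℝ).hasFDerivAt.comp x hf.hasFDerivAt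
  rw [h.fderiv]
  rfl

/-- A map of `ℝ^d` whose first-order partial derivatives are bounded by `L` has derivative of
norm at most `d² L`. -/
lemma norm_fderiv_apply_le_of_partial_le {d : ℕ} {L : ℝ} {f : Evec d → Evec d} {x : Evec d}
    (hf : DifferentiableAt ℝ f x)
    (h : ∀ J K : Fin d, |fderiv ℝ (fun y => f y J) x (EuclideanSpace.single K (1 : ℝ))| ≤ L)
    (v : Evec d) : ‖fderiv ℝ f x v‖ ≤ (d : ℝ) ^ 2 * L * ‖v‖ := by
  have hv : v = ∑ K, v K • EuclideanSpace.single K (1 : ℝ) := by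
    ext K
    simp [Finset.sum_apply, Pi.single_apply]
  have hJ (J : Fin d) : |(fderiv ℝ f x v) J| ≤ d * L * ‖v‖ := by
    rw [← fderiv_coord_apply hf]
    conv_lhs => rw [hv]
    rw [map_sum]
    calc |∑ K, fderiv ℝ (fun y => f y J) x (v K • EuclideanSpace.single K (1 : ℝ))|
        ≤ ∑ K : Fin d, ‖v‖ * L := by
          refine (Finset.abs_sum_le_sum_abs _ _).trans (Finset.sum_le_sum fun K _ => ?_)
          rw [map_smul, smul_eq_mul, abs_mul]
          exact mul_le_mul (PiLp.norm_apply_le v K) (h J K) (abs_nonneg _) (norm_nonneg _)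
      _ = d * L * ‖v‖ := by simp; ring
  set w := fderiv ℝ f x v
  have hw : w = ∑ J, w J • EuclideanSpace.single J (1 : ℝ) := by
    ext K
    simp [Finset.sum_apply, Pi.single_apply]
  rw [hw]
  calc ‖∑ J, w J • EuclideanSpace.single J (1 : ℝ)‖
      ≤ ∑ J : Fin d, d * L * ‖v‖ := by
        refine (norm_sum_le _ _).trans (Finset.sum_le_sum fun J _ => ?_)
        rw [norm_smul, PiLp.norm_single]
        simpa using hJ J
    _ = (d : ℝ) ^ 2 * L * ‖v‖ := by simp; ring

section StageSum

variable {d m s : ℕ} {M : Type} [Fintype M]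

/-- The coefficient function attached to an index pair, with `b^0 = a`. -/
def stageField (a : Evec d → Evec d) (b : Fin m → Evec d → Evec d) :
    SIdx m M → Evec d → Evec d
  | .det => a
  | .sto r _ => b r

/-- The combination of a family of vectors with the weights `Z` in row `i`. -/
def stageSum (c : SRK m s M) (θ : Mbar M → ℝ) (p : SIdx m M) (i : Fin s)
    (f : SIdx m M → Fin s → Evec d) : Evec d :=
  (∑ j, c.Z θ p .det i j • f .det j) + ∑ j, ∑ r, ∑ μ, c.Z θ p (.sto r μ) i j • f (.sto r μ) j

lemma stageEq_iff (c : SRK m s M) (a : Evec d → Evec d) (b : Fin m → Evec d → Evec d)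
    (y0 : Evec d) (θ : Mbar M → ℝ) (H : SIdx m M → Fin s → Evec d) :
    StageEq c a b y0 θ H ↔
      ∀ p i, H p i = y0 + stageSum c θ p i fun q j => stageField a b q (H q j) := by
  simp only [StageEq, stageSum, stageField, add_assoc]

lemma SRK.Z_add_smul (c : SRK m s M) (θ η : Mbar M → ℝ) (t : ℝ) (p q : SIdx m M) (i j : Fin s) :
    c.Z (θ + t • η) p q i j = c.Z θ p q i j + t * c.Z η p q i j := by
  cases q with
  | det => simp only [SRK.Z, Pi.add_apply, Pi.smul_apply, smul_eq_mul]; ring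
  | sto r μ =>
    simp only [SRK.Z, Pi.add_apply, Pi.smul_apply, smul_eq_mul, Finset.mul_sum,
      ← Finset.sum_add_distrib]
    exact Finset.sum_congr rfl fun _ _ => by ring

lemma SRK.sum_abs_Z_det_le {c : SRK m s M} {C2 t : ℝ} {θ : Mbar M → ℝ} (ht : 0 ≤ t)
    (hA : ∀ p i, ∑ j, |c.A p i j| ≤ C2) (hθ : ∀ ι, |θ ι| ≤ t) (p : SIdx m M) (i : Fin s) :
    ∑ j, |c.Z θ p .det i j| ≤ t * C2 := by
  calc ∑ j, |c.Z θ p .det i j| ≤ ∑ j, t * |c.A p i j| := by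
        refine Finset.sum_le_sum fun j _ => ?_
        simp only [SRK.Z, abs_mul]
        rw [mul_comm]
        exact mul_le_mul_of_nonneg_right (hθ none) (abs_nonneg _)
    _ = t * ∑ j, |c.A p i j| := (Finset.mul_sum ..).symm
    _ ≤ t * C2 := mul_le_mul_of_nonneg_left (hA p i) ht

lemma SRK.sum_abs_Z_sto_le {c : SRK m s M} {C2 t : ℝ} {θ : Mbar M → ℝ} (ht : 0 ≤ t)
    (hB : ∀ ι p r μ i, ∑ j, |c.B ι p r μ i j| ≤ C2) (hθ : ∀ ι, |θ ι| ≤ t)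
    (p : SIdx m M) (r : Fin m) (μ : M) (i : Fin s) :
    ∑ j, |c.Z θ p (.sto r μ) i j| ≤ t * (Fintype.card M * C2) := by
  calc ∑ j, |c.Z θ p (.sto r μ) i j| ≤ ∑ j, ∑ ι : M, t * |c.B ι p r μ i j| := by
        refine Finset.sum_le_sum fun j _ => (Finset.abs_sum_le_sum_abs _ _).trans
          (Finset.sum_le_sum fun ι _ => ?_)
        rw [abs_mul, mul_comm]
        exact mul_le_mul_of_nonneg_right (hθ _) (abs_nonneg _)
    _ = t * ∑ ι : M, ∑ j, |c.B ι p r μ i j| := by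
        rw [Finset.sum_comm, Finset.mul_sum]
        simp only [Finset.mul_sum]
    _ ≤ t * ∑ _ι : M, C2 :=
        mul_le_mul_of_nonneg_left (Finset.sum_le_sum fun ι _ => hB ι p r μ i) ht
    _ = t * (Fintype.card M * C2) := by simp

lemma norm_stageSum_le {c : SRK m s M} {C2 t X : ℝ} {θ : Mbar M → ℝ} (ht : 0 ≤ t)
    (hA : ∀ p i, ∑ j, |c.A p i j| ≤ C2) (hB : ∀ ι p r μ i, ∑ j, |c.B ι p r μ i j| ≤ C2)
    (hθ : ∀ ι, |θ ι| ≤ t) {f : SIdx m M → Fin s → Evec d} (hf : ∀ q j, ‖f q j‖ ≤ X)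
    (p : SIdx m M) (i : Fin s) :
    ‖stageSum c θ p i f‖ ≤ t * (C2 * (1 + m * (Fintype.card M : ℝ) ^ 2)) * X := by
  have hX : 0 ≤ X := (norm_nonneg _).trans (hf p i)
  have key (q : SIdx m M) : ∑ j, ‖c.Z θ p q i j • f q j‖ ≤ (∑ j, |c.Z θ p q i j|) * X := by
    rw [Finset.sum_mul]
    refine Finset.sum_le_sum fun j _ => ?_
    rw [norm_smul, Real.norm_eq_abs]
    exact mul_le_mul_of_nonneg_left (hf q j) (abs_nonneg _)
  have h1 : ‖∑ j, c.Z θ p .det i j • f .det j‖ ≤ t * C2 * X :=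
    (norm_sum_le _ _).trans <| (key _).trans <|
      mul_le_mul_of_nonneg_right (SRK.sum_abs_Z_det_le ht hA hθ p i) hX
  have h2 : ‖∑ j, ∑ r, ∑ μ, c.Z θ p (.sto r μ) i j • f (.sto r μ) j‖ ≤
      ∑ _r : Fin m, ∑ _μ : M, t * (Fintype.card M * C2) * X := by
    rw [Finset.sum_comm]
    refine (norm_sum_le _ _).trans (Finset.sum_le_sum fun r _ => ?_)
    rw [Finset.sum_comm]
    refine (norm_sum_le _ _).trans (Finset.sum_le_sum fun μ _ => ?_)
    exact (norm_sum_le _ _).trans <| (key _).trans <|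
      mul_le_mul_of_nonneg_right (SRK.sum_abs_Z_sto_le ht hB hθ p r μ i) hX
  refine (norm_add_le _ _).trans ((add_le_add h1 h2).trans (le_of_eq ?_))
  simp only [Finset.sum_const, Finset.card_univ, Fintype.card_fin, nsmul_eq_mul]
  ring

lemma hasDerivAt_stageSum (c : SRK m s M) (θ η : Mbar M → ℝ) (p : SIdx m M) (i : Fin s)
    {f : ℝ → SIdx m M → Fin s → Evec d} {f' : SIdx m M → Fin s → Evec d}
    (hf : ∀ q j, HasDerivAt (fun t => f t q j) (f' q j) 0) :
    HasDerivAt (fun t : ℝ => stageSum c (θ + t • η) p i (f t))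
      (stageSum c θ p i f' + stageSum c η p i (f 0)) 0 := by
  have hterm (q : SIdx m M) (j : Fin s) :
      HasDerivAt (fun t : ℝ => c.Z (θ + t • η) p q i j • f t q j)
        (c.Z θ p q i j • f' q j + c.Z η p q i j • f 0 q j) 0 := by
    have hZ : HasDerivAt (fun t : ℝ => c.Z (θ + t • η) p q i j) (c.Z η p q i j) 0 := by
      simp only [SRK.Z_add_smul]
      simpa using ((hasDerivAt_id (0 : ℝ)).mul_const (c.Z η p q i j)).const_add (c.Z θ p q i j)
    exact (hZ.fun_smul (hf q j)).congr_deriv (by simp)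
  have h := (HasDerivAt.fun_sum (u := Finset.univ) fun j _ => hterm .det j).add
    (HasDerivAt.fun_sum (u := Finset.univ) fun j _ =>
      HasDerivAt.fun_sum (u := Finset.univ) fun r _ =>
        HasDerivAt.fun_sum (u := Finset.univ) fun μ _ => hterm (.sto r μ) j)
  refine h.congr_deriv ?_
  simp only [stageSum, Finset.sum_add_distrib]
  abel

end StageSum

/-- First-derivative bound for the SRK stage values, with constants
depending only on `d`, `m`, `s`, `|M|`, `C1`, `C2` and `L`. -/
theorem srk_stage_first_derivative_bound
    (d m s : ℕ) (M : Type) [Fintype M] [DecidableEq M]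
    (C1 C2 L : ℝ) (hC1 : 0 < C1) (hC2 : 1 ≤ C2) (hL : 0 ≤ L) :
    ∃ ceps > (0:ℝ), ∃ C > (0:ℝ),
      ∀ (c : SRK m s M) (a : Evec d → Evec d) (b : Fin m → Evec d → Evec d),
        (∀ x, ‖a x‖ ≤ C1 * (1 + ‖x‖)) → (∀ k x, ‖b k x‖ ≤ C1 * (1 + ‖x‖)) →
        ContDiff ℝ 1 a → (∀ k, ContDiff ℝ 1 (b k)) →
        (∀ (x : Evec d) (J K : Fin d),
          |fderiv ℝ (fun y => a y J) x (EuclideanSpace.single K (1:ℝ))| ≤ L) →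
        (∀ (k : Fin m) (x : Evec d) (J K : Fin d),
          |fderiv ℝ (fun y => b k y J) x (EuclideanSpace.single K (1:ℝ))| ≤ L) →
        (∀ (p : SIdx m M) (i : Fin s), ∑ j, |c.A p i j| ≤ C2) →
        (∀ (ι : M) (p : SIdx m M) (r : Fin m) (μ : M) (i : Fin s),
          ∑ j, |c.B ι p r μ i j| ≤ C2) →
        ∀ (Yn : Evec d) (θs : Mbar M → ℝ) (U : Set (Mbar M → ℝ)),
          IsOpen U → θs ∈ U →
          ∀ H : (Mbar M → ℝ) → SIdx m M → Fin s → Evec d,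
            (∀ (p : SIdx m M) (i : Fin s), ContDiffOn ℝ 1 (fun θ => H θ p i) U) →
            (∀ θ ∈ U, StageEq c a b Yn θ (H θ)) →
            (∀ ι : Mbar M, |θs ι| ≤ ceps) →
            ∀ (p : SIdx m M) (i : Fin s) (J : Fin d),
              |∑ ν1 : Mbar M, fderiv ℝ (fun θ => H θ p i J) θs (Pi.single ν1 1)|
                ≤ C * (1 + ‖Yn‖) := by
  set G : ℝ := C2 * (1 + m * (Fintype.card M : ℝ) ^ 2)
  set K : ℝ := (d : ℝ) ^ 2 * L
  have hGpos : 0 < G := by positivity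
  have hKnn : 0 ≤ K := by positivity
  refine ⟨1 / (2 * (G * (C1 + K))), by positivity, 4 * (G * C1), by positivity, ?_⟩
  intro c a b hagr hbgr ha hb haL hbL hA hB Yn θs U hU hθU H hH hstage hθ p i J
  set ε : ℝ := 1 / (2 * (G * (C1 + K))) with hε
  have hεpos : 0 < ε := by positivity
  have hεG : ε * G * (C1 + K) = 1 / 2 := by rw [hε]; field_simp
  have hεC : ε * G * C1 ≤ 1 / 2 := by nlinarith [mul_pos hεpos hGpos]
  have hεK : ε * G * K ≤ 1 / 2 := by nlinarith [mul_pos hεpos hGpos]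
  have hgr (q : SIdx m M) (x : Evec d) : ‖stageField a b q x‖ ≤ C1 * (1 + ‖x‖) := by
    cases q with
    | det => exact hagr x
    | sto r μ => exact hbgr r x
  have hdiff (q : SIdx m M) (x : Evec d) : DifferentiableAt ℝ (stageField a b q) x := by
    cases q with
    | det => exact (ha.differentiable one_ne_zero) x
    | sto r μ => exact ((hb r).differentiable one_ne_zero) x
  have hder (q : SIdx m M) (x v : Evec d) :
      ‖fderiv ℝ (stageField a b q) x v‖ ≤ K * ‖v‖ := by
    refine norm_fderiv_apply_le_of_partial_le (hdiff q x) ?_ v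
    cases q with
    | det => exact haL x
    | sto r μ => exact hbL r x
  have hst : ∀ θ ∈ U, ∀ p i,
      H θ p i = Yn + stageSum c θ p i fun q j => stageField a b q (H θ q j) :=
    fun θ h => (stageEq_iff c a b Yn θ (H θ)).1 (hstage θ h)
  have hHb (q : SIdx m M) (j : Fin s) : ‖H θs q j‖ ≤ 2 * (‖Yn‖ + 1 / 2) := by
    refine le_two_mul_of_contraction (f := fun x : SIdx m M × Fin s => ‖H θs x.1 x.2‖)
      (fun X hX x => ?_) (q, j)
    have hX0 : 0 ≤ X := (norm_nonneg _).trans (hX x)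
    have hs := norm_stageSum_le hεpos.le hA hB hθ (X := C1 * (1 + X))
      (f := fun q j => stageField a b q (H θs q j))
      (fun q j => (hgr q _).trans (by have := hX (q, j); gcongr)) x.1 x.2
    change ‖H θs x.1 x.2‖ ≤ _
    rw [hst θs hθU]
    refine (norm_add_le _ _).trans ?_
    nlinarith
  set e : Mbar M → ℝ := fun _ => 1 with he
  have hHd (q : SIdx m M) (j : Fin s) : DifferentiableAt ℝ (fun θ => H θ q j) θs :=
    ((hH q j).differentiableOn one_ne_zero).differentiableAt (hU.mem_nhds hθU)
  set D : SIdx m M → Fin s → Evec d := fun q j => fderiv ℝ (fun θ => H θ q j) θs e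
  have hline : HasDerivAt (fun t : ℝ => θs + t • e) e 0 := by
    simpa using ((hasDerivAt_id (0 : ℝ)).smul_const e).const_add θs
  have hHl (q : SIdx m M) (j : Fin s) :
      HasDerivAt (fun t : ℝ => H (θs + t • e) q j) (D q j) 0 := by
    have h0 : HasFDerivAt (fun θ => H θ q j) (fderiv ℝ (fun θ => H θ q j) θs)
        (θs + (0 : ℝ) • e) := by simpa using (hHd q j).hasFDerivAt
    exact h0.comp_hasDerivAt (0 : ℝ) hline
  have hfl (q : SIdx m M) (j : Fin s) :
      HasDerivAt (fun t : ℝ => stageField a b q (H (θs + t • e) q j))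
        (fderiv ℝ (stageField a b q) (H θs q j) (D q j)) 0 := by
    have h0 : HasFDerivAt (stageField a b q) (fderiv ℝ (stageField a b q) (H θs q j))
        (H (θs + (0 : ℝ) • e) q j) := by simpa using (hdiff q (H θs q j)).hasFDerivAt
    exact h0.comp_hasDerivAt (0 : ℝ) (hHl q j)
  have hDeq (q : SIdx m M) (j : Fin s) :
      D q j = stageSum c θs q j (fun q j => fderiv ℝ (stageField a b q) (H θs q j) (D q j))
        + stageSum c e q j (fun q j => stageField a b q (H θs q j)) := by
    have h1 := (hasDerivAt_stageSum c θs e q j hfl).const_add Yn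
    have hU' : ∀ᶠ t : ℝ in nhds 0, θs + t • e ∈ U :=
      hline.continuousAt.eventually (hU.mem_nhds (by simpa using hθU))
    have h2 := h1.congr_of_eventuallyEq (hU'.mono fun t ht => hst _ ht q j)
    simpa using (hHl q j).unique h2
  have hDb : ‖D p i‖ ≤ 2 * (2 * (G * C1) * (1 + ‖Yn‖)) := by
    refine le_two_mul_of_contraction (f := fun x : SIdx m M × Fin s => ‖D x.1 x.2‖)
      (fun X hX x => ?_) (p, i)
    have hX0 : 0 ≤ X := (norm_nonneg _).trans (hX x)
    have hs1 := norm_stageSum_le hεpos.le hA hB hθ (X := K * X)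
      (f := fun q j => fderiv ℝ (stageField a b q) (H θs q j) (D q j))
      (fun q j => (hder q _ _).trans (mul_le_mul_of_nonneg_left (hX (q, j)) hKnn)) x.1 x.2
    have hs2 := norm_stageSum_le zero_le_one hA hB (θ := e) (by simp [he])
      (X := C1 * (1 + 2 * (‖Yn‖ + 1 / 2)))
      (f := fun q j => stageField a b q (H θs q j))
      (fun q j => (hgr q _).trans (by have := hHb q j; gcongr)) x.1 x.2
    change ‖D x.1 x.2‖ ≤ _
    rw [hDeq]
    refine (norm_add_le _ _).trans ?_
    nlinarith
  have hsum : ∑ ν1 : Mbar M, fderiv ℝ (fun θ => H θ p i J) θs (Pi.single ν1 1) = (D p i) J := by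
    have he' : ∑ ν1 : Mbar M, (Pi.single ν1 1 : Mbar M → ℝ) = e := by
      ext ν
      simp [he, Finset.sum_apply, Pi.single_apply]
    rw [← map_sum, he', fderiv_coord_apply (hHd p i)]
  rw [hsum]
  refine (PiLp.norm_apply_le (D p i) J).trans (hDb.trans (le_of_eq ?_))
  ring

end SRKPaper
end
end

section
/- Pathwise one-step increment bound for the SRK method: Suppose b^0=a, b^1,…,b^m satisfy the linear growth condition ‖b^k(x)‖ ≤ C_1(1+‖x‖), let C_2 ≥ 1 bound the operator norms of all coefficient matrices B^{(ι)(k,ν),(r,μ)}, A^{(k,ν),(0,0)} and all weight vectors γ^{(ι)(k,ν)}, α, and put C_3=(m+1)|M̄|^2 C_1 C_2. Let 0<h<1, C_ϑ ≥ 1, and suppose the realized values θ_ι, ι∈M̄ (with θ_0=h), satisfy |θ_ι| ≤ min{1/(2C_3), √h·C_ϑ} for all ι∈M̄. Then for every x∈ℝ^d and every family of stage values solving the stage equations with starting value x, the one-step value Y(t)=A(t_n,x,θ) satisfies ‖Y(t) − x‖ ≤ C(1+‖x‖)·√h for a constant C depending only on m, |M|, C_1, C_2, C_3, C_ϑ.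 -/
open scoped BigOperators
open Finset MeasureTheory ProbabilityTheory

noncomputable section

namespace SRKPaper

instance inst_s12 {m : ℕ} {M : Type} [Finite M] : Finite (SIdx m M) := by
  refine Finite.of_surjective
    (fun o : Option (Fin m × M) => o.elim SIdx.det fun q => SIdx.sto q.1 q.2) ?_
  rintro (_ | ⟨k, ν⟩)
  · exact ⟨none, rfl⟩
  · exact ⟨some (k, ν), rfl⟩

/-- Weighted sums of vectors of norm at most `K` are bounded by `K` times a bound for the
sum of the absolute weights. -/
theorem norm_sum_mul_smul_le {E : Type*} [NormedAddCommGroup E] [NormedSpace ℝ E] {s : ℕ}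
    {C T K θ : ℝ} (hC : 0 ≤ C) (hK : 0 ≤ K) (u : Fin s → ℝ) (F : Fin s → E)
    (hu : ∑ j, |u j| ≤ C) (hθ : |θ| ≤ T) (hF : ∀ j, ‖F j‖ ≤ K) :
    ‖∑ j, (u j * θ) • F j‖ ≤ C * T * K := by
  calc ‖∑ j, (u j * θ) • F j‖ ≤ ∑ j, |u j| * (|θ| * K) := by
        refine norm_sum_le_of_le _ fun j _ => ?_
        rw [norm_smul, Real.norm_eq_abs, abs_mul, mul_assoc]
        have := hF j
        gcongr
    _ = (∑ j, |u j|) * (|θ| * K) := by rw [Finset.sum_mul]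
    _ ≤ C * (T * K) := by gcongr
    _ = C * T * K := by ring

/-- The increment of a stochastic Runge–Kutta stage or step, for increments `θ` bounded by `T`
and coefficient values bounded by `K`. -/
theorem norm_srk_increment_le {E : Type*} [NormedAddCommGroup E] [NormedSpace ℝ E]
    {m s : ℕ} {M : Type} [Fintype M] {C T K : ℝ} (hC : 0 ≤ C) (hK : 0 ≤ K)
    (u : Fin s → ℝ) (v : M → Fin m → M → Fin s → ℝ) (θ : Mbar M → ℝ)
    (F : Fin s → E) (G : Fin m → M → Fin s → E)
    (hu : ∑ j, |u j| ≤ C) (hv : ∀ ι r μ, ∑ j, |v ι r μ j| ≤ C) (hθ : ∀ ι, |θ ι| ≤ T)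
    (hF : ∀ j, ‖F j‖ ≤ K) (hG : ∀ r μ j, ‖G r μ j‖ ≤ K) :
    ‖(∑ j, (u j * θ none) • F j)
      + ∑ j, ∑ r, ∑ μ, (∑ ι : M, v ι r μ j * θ (some ι)) • G r μ j‖
      ≤ ((m : ℝ) + 1) * ((Fintype.card M : ℝ) + 1) ^ 2 * (C * T * K) := by
  have hT : 0 ≤ T := (abs_nonneg _).trans (hθ none)
  have hsto : ‖∑ j, ∑ r, ∑ μ, (∑ ι : M, v ι r μ j * θ (some ι)) • G r μ j‖
      ≤ (m : ℝ) * (Fintype.card M : ℝ) ^ 2 * (C * T * K) := by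
    have hcomm : ∑ j, ∑ r, ∑ μ, (∑ ι : M, v ι r μ j * θ (some ι)) • G r μ j
        = ∑ r, ∑ μ, ∑ ι : M, ∑ j, (v ι r μ j * θ (some ι)) • G r μ j := by
      simp only [Finset.sum_smul]
      rw [Finset.sum_comm]
      refine Finset.sum_congr rfl fun r _ => ?_
      rw [Finset.sum_comm]
      exact Finset.sum_congr rfl fun μ _ => Finset.sum_comm
    rw [hcomm]
    calc _ ≤ ∑ _r : Fin m, ∑ _μ : M, ∑ _ι : M, C * T * K :=
          norm_sum_le_of_le _ fun r _ => norm_sum_le_of_le _ fun μ _ =>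
            norm_sum_le_of_le _ fun ι _ =>
              norm_sum_mul_smul_le hC hK _ _ (hv ι r μ) (hθ _) (hG r μ)
      _ = _ := by
          simp only [Finset.sum_const, Finset.card_univ, Fintype.card_fin, nsmul_eq_mul]
          ring
  calc _ ≤ C * T * K + (m : ℝ) * (Fintype.card M : ℝ) ^ 2 * (C * T * K) :=
        norm_add_le_of_le (norm_sum_mul_smul_le hC hK _ _ hu (hθ none) hF) hsto
    _ = (1 + (m : ℝ) * (Fintype.card M : ℝ) ^ 2) * (C * T * K) := by ring
    _ ≤ _ := by
        gcongr
        have hm : (0 : ℝ) ≤ m := m.cast_nonneg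
        have hM : (0 : ℝ) ≤ Fintype.card M := Nat.cast_nonneg _
        nlinarith [mul_nonneg hm hM, mul_nonneg hM hM]

/-- Pathwise one-step increment bound `‖Y(t)−x‖ ≤ C(1+‖x‖)√h` for the
SRK method, with a constant depending only on `m`, `|M| = κ`, `C1`, `C2`, `C3`, `C_ϑ`. -/
theorem srk_pathwise_increment_bound
    (m κ : ℕ) (C1 C2 C3 Cϑ : ℝ) (hC1 : 0 < C1) (hC2 : 1 ≤ C2) (hCϑ : 1 ≤ Cϑ)
    (hC3 : C3 = ((m : ℝ) + 1) * ((κ : ℝ) + 1)^2 * C1 * C2) :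
    ∃ C > (0:ℝ),
      ∀ (d s : ℕ) (M : Type) (_ : Fintype M) (_ : DecidableEq M),
        Fintype.card M = κ →
        ∀ (c : SRK m s M) (a : Evec d → Evec d) (b : Fin m → Evec d → Evec d),
          (∀ x, ‖a x‖ ≤ C1 * (1 + ‖x‖)) → (∀ k x, ‖b k x‖ ≤ C1 * (1 + ‖x‖)) →
          (∀ (p : SIdx m M) (i : Fin s), ∑ j, |c.A p i j| ≤ C2) →
          (∀ (ι : M) (p : SIdx m M) (r : Fin m) (μ : M) (i : Fin s),
            ∑ j, |c.B ι p r μ i j| ≤ C2) →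
          (∑ i, |c.α i| ≤ C2) →
          (∀ (ι : M) (p : SIdx m M), ∑ i, |c.γc ι p i| ≤ C2) →
          ∀ h : ℝ, 0 < h → h < 1 →
            ∀ θ : Mbar M → ℝ, θ none = h →
              (∀ ι : Mbar M, |θ ι| ≤ min (1/(2*C3)) (Real.sqrt h * Cϑ)) →
              ∀ (x : Evec d) (H : SIdx m M → Fin s → Evec d),
                StageEq c a b x θ H →
                ‖oneStep c a b x θ H - x‖ ≤ C * (1 + ‖x‖) * Real.sqrt h := by
  have hC3pos : 0 < C3 := by rw [hC3]; positivity
  refine ⟨2 * C3 * Cϑ, by positivity, ?_⟩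
  rintro d s M _ _ rfl c a b ha hb hA hB hα hγ h _ _ θ - hθ x H hH
  rcases Nat.eq_zero_or_pos s with rfl | hs
  · simp only [oneStep, Finset.univ_eq_empty, Finset.sum_empty, add_zero, sub_self, norm_zero]
    positivity
  have hC2' : 0 ≤ C2 := by linarith
  have : Nonempty (SIdx m M × Fin s) := ⟨(.det, ⟨0, hs⟩)⟩
  obtain ⟨⟨p₀, i₀⟩, hmax⟩ := Finite.exists_max fun q : SIdx m M × Fin s => ‖H q.1 q.2‖
  set R := ‖H p₀ i₀‖ with hR
  have hR0 : 0 ≤ R := norm_nonneg _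
  have hK : 0 ≤ C1 * (1 + R) := by positivity
  have haK : ∀ j, ‖a (H .det j)‖ ≤ C1 * (1 + R) := fun j =>
    (ha _).trans (by have := hmax (.det, j); gcongr)
  have hbK : ∀ r μ j, ‖b r (H (.sto r μ) j)‖ ≤ C1 * (1 + R) := fun r μ j =>
    (hb r _).trans (by have := hmax (.sto r μ, j); gcongr)
  have hstage : ‖H p₀ i₀ - x‖ ≤ (1 + R) / 2 := by
    have key := norm_srk_increment_le hC2' hK (c.A p₀ i₀) (fun ι r μ => c.B ι p₀ r μ i₀) θ _ _
      (hA p₀ i₀) (fun ι r μ => hB ι p₀ r μ i₀) (fun ι => (hθ ι).trans (min_le_left _ _)) haK hbK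
    rw [hH p₀ i₀, add_assoc, add_sub_cancel_left]
    refine key.trans_eq ?_
    calc _ = C3 * (1 / (2 * C3)) * (1 + R) := by rw [hC3]; ring
      _ = (1 + R) / 2 := by field_simp
  have hbound : 1 + R ≤ 2 * (1 + ‖x‖) := by
    have := norm_le_norm_add_norm_sub' (H p₀ i₀) x
    linarith
  have key := norm_srk_increment_le hC2' hK c.α (fun ι r μ => c.γc ι (.sto r μ)) θ _ _
    hα (fun ι r μ => hγ ι (.sto r μ)) (fun ι => (hθ ι).trans (min_le_right _ _)) haK hbK
  rw [oneStep, add_assoc, add_sub_cancel_left]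
  refine key.trans ?_
  calc _ = C3 * (√h * Cϑ) * (1 + R) := by rw [hC3]; ring
    _ ≤ C3 * (√h * Cϑ) * (2 * (1 + ‖x‖)) := by gcongr
    _ = _ := by ring

end SRKPaper
end
end
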